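/- arXiv:2605.27058 — 2 statements merged into one kernel-verified Lean document; each statement's English description precedes it below -/
import Mathlib

section
/- Let r, s ≥ 2 and t ≥ 1 be integers, and let ε₁, ε₂ ∈ {1, −1}. Write ν₂ for the 2-adic valuation on the integers, and set μ_r = ν₂(r), μ_s = ν₂(s), μ_t = ν₂(t). Let m₀ ≥ 1 be the minimal integer such that r^{m₀} > t and μ_r·(μ_r·m₀ − μ_t − 2) ≥ 0, and let n₀ ≥ 1 be the minimal integer such that s^{n₀} > t and μ_s·(μ_s·n₀ − μ_t − 2) ≥ 0. Define V to be the set of pairs (m,n) of integers with m ≥ m₀ and n ≥ n₀ such that there exist λ ∈ ℂ^× and η, κ ∈ {1, −1} with λ^{r^m − η·t} = ε₁ and λ^{s^n − κ·t} = ε₂ (integer exponents). Then either V = ∅ or V = {(m,n) : m ≥ m₀, n ≥ n₀}. -/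
/-- The set `V(r,s,t,ε₁,ε₂)` of Proposition `powerpm1not0`. -/
def Vset (r s t m₀ n₀ : ℕ) (ε₁ ε₂ : ℂ) : Set (ℕ × ℕ) :=
  {p : ℕ × ℕ | m₀ ≤ p.1 ∧ n₀ ≤ p.2 ∧
    ∃ (lam : ℂ) (η κ : ℤ), lam ≠ 0 ∧ (η = 1 ∨ η = -1) ∧ (κ = 1 ∨ κ = -1) ∧
      lam ^ ((r : ℤ) ^ p.1 - η * t) = ε₁ ∧ lam ^ ((s : ℤ) ^ p.2 - κ * t) = ε₂}

lemma exists_odd_eq_two_pow_padicValInt_mul {a : ℤ} (ha : a ≠ 0) :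
    ∃ d : ℤ, Odd d ∧ a = 2 ^ padicValInt 2 a * d := by
  obtain ⟨d, hd⟩ : (2 : ℤ) ^ padicValInt 2 a ∣ a := by
    exact_mod_cast (padicValInt_dvd (p := 2) a)
  refine ⟨d, ?_, hd⟩
  rw [← Int.not_even_iff_odd, even_iff_two_dvd]
  rintro ⟨e, rfl⟩
  have hdvd : (2 : ℤ) ^ (padicValInt 2 a + 1) ∣ a := ⟨e, by rw [pow_succ, mul_assoc]; exact hd⟩
  have := (padicValInt_dvd_iff (p := 2) (padicValInt 2 a + 1) a).1 (by exact_mod_cast hdvd)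
  omega

lemma padicValInt_two_pow_mul_of_odd (k : ℕ) {d : ℤ} (hd : Odd d) :
    padicValInt 2 (2 ^ k * d) = k := by
  have hd0 : d ≠ 0 := by rintro rfl; simp at hd
  have hd1 : padicValInt 2 d = 0 := padicValInt.eq_zero_of_not_dvd fun h =>
    Int.not_even_iff_odd.2 hd (even_iff_two_dvd.2 (by exact_mod_cast h))
  rw [padicValInt.mul (by positivity) hd0, hd1]
  simp [padicValInt, Int.natAbs_pow]

/-- An integer with `λ ^ b = -1` has smaller 2-adic valuation than any `c ≠ 0` with `λ ^ c = 1`. -/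
lemma padicValInt_two_lt_of_zpow_eq {lam : ℂ} {b c : ℤ} (hc : c ≠ 0) (hb1 : lam ^ b = -1)
    (hc1 : lam ^ c = 1) : padicValInt 2 b < padicValInt 2 c := by
  by_contra! h
  obtain ⟨c', hodd, hc'⟩ := exists_odd_eq_two_pow_padicValInt_mul hc
  obtain ⟨b', hb'⟩ : (2 : ℤ) ^ padicValInt 2 c ∣ b :=
    (pow_dvd_pow 2 h).trans (by exact_mod_cast (padicValInt_dvd (p := 2) b))
  have key : lam ^ (b * c') = lam ^ (c * b') := by
    congr 1
    linear_combination c' * hb' - b' * hc'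
  rw [zpow_mul, zpow_mul, hb1, hc1, one_zpow, hodd.neg_one_zpow] at key
  norm_num at key

lemma exists_zpow_eq_neg_one (k : ℕ) :
    ∃ lam : ℂ, lam ≠ 0 ∧ ∀ b : ℤ, b ≠ 0 →
      (padicValInt 2 b = k → lam ^ b = -1) ∧ (k < padicValInt 2 b → lam ^ b = 1) := by
  obtain ⟨lam, hlam⟩ := IsAlgClosed.exists_pow_nat_eq (-1 : ℂ) (pow_pos two_pos k)
  have hz : lam ^ ((2 : ℤ) ^ k) = -1 := by
    rw [← hlam, ← zpow_natCast]; push_cast; rfl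
  refine ⟨lam, ?_, fun b hb => ⟨fun h => ?_, fun h => ?_⟩⟩
  · rintro rfl
    simp at hlam
  · obtain ⟨d, hodd, hd⟩ := exists_odd_eq_two_pow_padicValInt_mul hb
    rw [hd, h, zpow_mul, hz, hodd.neg_one_zpow]
  · obtain ⟨d, hd⟩ : (2 : ℤ) ^ (k + 1) ∣ b :=
      (pow_dvd_pow 2 h).trans (by exact_mod_cast (padicValInt_dvd (p := 2) b))
    rw [hd, pow_succ, mul_assoc, zpow_mul, hz, zpow_mul]
    simp

lemma exists_zpow_eq_neg_one_and_one_iff {a b : ℤ} (ha : a ≠ 0) (hb : b ≠ 0) :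
    (∃ lam : ℂ, lam ≠ 0 ∧ lam ^ a = -1 ∧ lam ^ b = 1) ↔ padicValInt 2 a < padicValInt 2 b := by
  constructor
  · rintro ⟨lam, -, h1, h2⟩
    exact padicValInt_two_lt_of_zpow_eq hb h1 h2
  · intro h
    obtain ⟨lam, h0, hl⟩ := exists_zpow_eq_neg_one (padicValInt 2 a)
    exact ⟨lam, h0, (hl a ha).1 rfl, (hl b hb).2 h⟩

lemma exists_zpow_eq_neg_one_and_neg_one_iff {a b : ℤ} (ha : a ≠ 0) (hb : b ≠ 0) :
    (∃ lam : ℂ, lam ≠ 0 ∧ lam ^ a = -1 ∧ lam ^ b = -1) ↔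
      padicValInt 2 a = padicValInt 2 b := by
  constructor
  · rintro ⟨lam, -, h1, h2⟩
    have two_mul_val {c : ℤ} (hc : c ≠ 0) : padicValInt 2 (c * 2) = padicValInt 2 c + 1 := by
      exact_mod_cast padicValInt_mul_eq_succ (p := 2) c hc
    have hlt {c d : ℤ} (hc : c ≠ 0) (h1 : lam ^ d = -1) (h2 : lam ^ c = -1) :
        padicValInt 2 d < padicValInt 2 c + 1 := by
      rw [← two_mul_val hc]
      exact padicValInt_two_lt_of_zpow_eq (by simpa using hc) h1 (by simp [zpow_mul, h2])
    have := hlt ha h2 h1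
    have := hlt hb h1 h2
    omega
  · intro h
    obtain ⟨lam, h0, hl⟩ := exists_zpow_eq_neg_one (padicValInt 2 a)
    exact ⟨lam, h0, (hl a ha).1 rfl, (hl b hb).1 h.symm⟩

lemma padicValInt_two_sub_of_two_pow_dvd {x t η : ℤ} (ht : t ≠ 0) (hη : η = 1 ∨ η = -1)
    (hx : 2 ^ (padicValInt 2 t + 1) ∣ x) : padicValInt 2 (x - η * t) = padicValInt 2 t := by
  obtain ⟨d, hodd, hd⟩ := exists_odd_eq_two_pow_padicValInt_mul ht
  obtain ⟨e, rfl⟩ := hx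
  have h : (2 : ℤ) ^ (padicValInt 2 t + 1) * e - η * t =
      2 ^ padicValInt 2 t * (2 * e - η * d) := by
    linear_combination (-η) * hd
  rw [h]
  apply padicValInt_two_pow_mul_of_odd
  rcases hη with rfl | rfl <;> grind

lemma padicValInt_two_eq_zero_of_odd {x : ℤ} (hx : Odd x) : padicValInt 2 x = 0 := by
  simpa using padicValInt_two_pow_mul_of_odd 0 hx

lemma padicValInt_two_eq_one {x : ℤ} (hx : x % 4 = 2) : padicValInt 2 x = 1 := by
  have h : x = 2 ^ 1 * (x / 2) := by omega
  rw [h]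
  exact padicValInt_two_pow_mul_of_odd 1 (Int.odd_iff.2 (by omega))

lemma two_le_padicValInt_two {x : ℤ} (hx : x ≠ 0) (h : 4 ∣ x) : 2 ≤ padicValInt 2 x :=
  ((padicValInt_dvd_iff (p := 2) 2 x).1 (by exact_mod_cast h)).resolve_left hx

/-- A family of natural numbers indexed by `m ≥ m₀` and a sign is either constant (with value zero
if `P` holds), or `P` holds and every pair of entries consists of `1` and a number `≥ 2`. -/
def SignValuationDichotomy (P : Prop) (m₀ : ℕ) (v : ℕ → ℤ → ℕ) : Prop :=
  (∃ c : ℕ, (P → c = 0) ∧ ∀ m, m₀ ≤ m → ∀ η : ℤ, (η = 1 ∨ η = -1) → v m η = c) ∨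
  (P ∧ ∀ m, m₀ ≤ m →
    (∀ η : ℤ, (η = 1 ∨ η = -1) → 1 ≤ v m η) ∧
    (∃ η : ℤ, (η = 1 ∨ η = -1) ∧ v m η = 1) ∧
    ∃ η : ℤ, (η = 1 ∨ η = -1) ∧ 2 ≤ v m η)

lemma exists_sign_iff_lt {P : Prop} {m₀ n₀ : ℕ} {v w : ℕ → ℤ → ℕ}
    (hv : SignValuationDichotomy P m₀ v) (hw : SignValuationDichotomy P n₀ w) :
    ∃ c : Prop, ∀ m n : ℕ, m₀ ≤ m → n₀ ≤ n →
      ((∃ η κ : ℤ, (η = 1 ∨ η = -1) ∧ (κ = 1 ∨ κ = -1) ∧ v m η < w n κ) ↔ c) := by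
  rcases hv with ⟨c, hc, hv⟩ | ⟨hP, hv⟩ <;> rcases hw with ⟨d, hd, hw⟩ | ⟨hQ, hw⟩
  · refine ⟨c < d, fun m n hm hn => ⟨?_, fun h => ⟨1, 1, .inl rfl, .inl rfl, ?_⟩⟩⟩
    · rintro ⟨η, κ, hη, hκ, h⟩
      rwa [hv m hm η hη, hw n hn κ hκ] at h
    · rwa [hv m hm 1 (.inl rfl), hw n hn 1 (.inl rfl)]
  · refine ⟨True, fun m n hm hn => iff_true_intro ⟨1, 1, .inl rfl, .inl rfl, ?_⟩⟩
    rw [hv m hm 1 (.inl rfl), hc hQ]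
    exact (hw n hn).1 1 (.inl rfl)
  · refine ⟨False, fun m n hm hn => iff_false_intro ?_⟩
    rintro ⟨η, κ, hη, hκ, h⟩
    rw [hw n hn κ hκ, hd hP] at h
    exact Nat.not_lt_zero _ h
  · refine ⟨True, fun m n hm hn => iff_true_intro ?_⟩
    obtain ⟨η, hη, h1⟩ := (hv m hm).2.1
    obtain ⟨κ, hκ, h2⟩ := (hw n hn).2.2
    exact ⟨η, κ, hη, hκ, by omega⟩

lemma exists_sign_iff_eq {P : Prop} {m₀ n₀ : ℕ} {v w : ℕ → ℤ → ℕ}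
    (hv : SignValuationDichotomy P m₀ v) (hw : SignValuationDichotomy P n₀ w) :
    ∃ c : Prop, ∀ m n : ℕ, m₀ ≤ m → n₀ ≤ n →
      ((∃ η κ : ℤ, (η = 1 ∨ η = -1) ∧ (κ = 1 ∨ κ = -1) ∧ v m η = w n κ) ↔ c) := by
  rcases hv with ⟨c, hc, hv⟩ | ⟨hP, hv⟩ <;> rcases hw with ⟨d, hd, hw⟩ | ⟨hQ, hw⟩
  · refine ⟨c = d, fun m n hm hn => ⟨?_, fun h => ⟨1, 1, .inl rfl, .inl rfl, ?_⟩⟩⟩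
    · rintro ⟨η, κ, hη, hκ, h⟩
      rwa [hv m hm η hη, hw n hn κ hκ] at h
    · rwa [hv m hm 1 (.inl rfl), hw n hn 1 (.inl rfl)]
  · refine ⟨False, fun m n hm hn => iff_false_intro ?_⟩
    rintro ⟨η, κ, hη, hκ, h⟩
    have := (hw n hn).1 κ hκ
    have := hv m hm η hη
    have := hc hQ
    omega
  · refine ⟨False, fun m n hm hn => iff_false_intro ?_⟩
    rintro ⟨η, κ, hη, hκ, h⟩
    have := (hv m hm).1 η hη
    have := hw n hn κ hκ
    have := hd hP
    omega
  · refine ⟨True, fun m n hm hn => iff_true_intro ?_⟩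
    obtain ⟨η, hη, h1⟩ := (hv m hm).2.1
    obtain ⟨κ, hκ, h2⟩ := (hw n hn).2.1
    exact ⟨η, κ, hη, hκ, by omega⟩

/-- For admissible `m`, the 2-adic valuations of `r ^ m - t` and `r ^ m + t` are either constant
(and zero when `t` is odd), or one of them is `1` and the other one is at least `2`. -/
lemma signValuationDichotomy_pow_sub {r t m₀ : ℕ} (ht : 1 ≤ t) (hr : 2 ≤ r)
    (hlt : ∀ m, m₀ ≤ m → t < r ^ m)
    (hv : 0 ≤ (padicValNat 2 r : ℤ) * ((padicValNat 2 r : ℤ) * m₀ - padicValNat 2 t - 2)) :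
    SignValuationDichotomy (Odd t) m₀ fun m η => padicValInt 2 ((r : ℤ) ^ m - η * t) := by
  have ht0 : (t : ℤ) ≠ 0 := by positivity
  rcases Nat.even_or_odd r with hre | hro
  · left
    refine ⟨padicValInt 2 t, fun h => padicValInt_two_eq_zero_of_odd (by exact_mod_cast h),
      fun m hm η hη => padicValInt_two_sub_of_two_pow_dvd ht0 hη ?_⟩
    have hpos : 0 < padicValNat 2 r :=
      one_le_padicValNat_of_dvd (by positivity) (even_iff_two_dvd.1 hre)
    have h1 : 0 ≤ (padicValNat 2 r : ℤ) * m₀ - padicValNat 2 t - 2 :=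
      nonneg_of_mul_nonneg_right hv (by exact_mod_cast hpos)
    have h2 : padicValNat 2 t + 1 ≤ padicValNat 2 r * m := by
      have : padicValNat 2 r * m₀ ≤ padicValNat 2 r * m := Nat.mul_le_mul_left _ hm
      norm_cast at h1
      lia
    have h3 : 2 ^ (padicValNat 2 r * m) ∣ r ^ m := by
      rw [pow_mul]
      exact pow_dvd_pow_of_dvd pow_padicValNat_dvd m
    rw [padicValInt.of_nat]
    exact_mod_cast (pow_dvd_pow 2 h2).trans h3
  · have hro' (m : ℕ) : Odd ((r : ℤ) ^ m) := by exact_mod_cast hro.pow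
    rcases Nat.even_or_odd t with hte | hto
    · left
      refine ⟨0, fun _ => rfl, fun m _ η _ => padicValInt_two_eq_zero_of_odd ?_⟩
      have : Even (t : ℤ) := by exact_mod_cast hte
      exact (hro' m).sub_even (this.mul_left η)
    · right
      refine ⟨hto, fun m hm => ?_⟩
      beta_reduce
      have hx := hro' m
      have hl : (t : ℤ) < (r : ℤ) ^ m := by exact_mod_cast hlt m hm
      have hto' : Odd (t : ℤ) := by exact_mod_cast hto
      rw [Int.odd_iff] at hx hto'
      generalize (r : ℤ) ^ m = x at *
      have h12 : (padicValInt 2 (x - 1 * t) = 1 ∧ 2 ≤ padicValInt 2 (x - -1 * t)) ∨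
          (2 ≤ padicValInt 2 (x - 1 * t) ∧ padicValInt 2 (x - -1 * t) = 1) := by
        rcases (by omega : (x - 1 * t) % 4 = 2 ∨ (x - -1 * t) % 4 = 2) with h | h
        · exact .inl ⟨padicValInt_two_eq_one h, two_le_padicValInt_two (by omega) (by omega)⟩
        · exact .inr ⟨two_le_padicValInt_two (by omega) (by omega), padicValInt_two_eq_one h⟩
      refine ⟨?_, ?_, ?_⟩
      · rintro η (rfl | rfl) <;> omega
      · rcases h12 with h | h
        exacts [⟨1, .inl rfl, h.1⟩, ⟨-1, .inr rfl, h.2⟩]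
      · rcases h12 with h | h
        exacts [⟨-1, .inr rfl, h.2⟩, ⟨1, .inl rfl, h.1⟩]

theorem Vset_empty_or_full (r s t : ℕ) (hr : 2 ≤ r) (hs : 2 ≤ s) (ht : 1 ≤ t)
    (ε₁ ε₂ : ℂ) (hε₁ : ε₁ = 1 ∨ ε₁ = -1) (hε₂ : ε₂ = 1 ∨ ε₂ = -1)
    (m₀ n₀ : ℕ)
    (hm₀ : 1 ≤ m₀ ∧ t < r ^ m₀ ∧
      0 ≤ (padicValNat 2 r : ℤ) * ((padicValNat 2 r : ℤ) * m₀ - padicValNat 2 t - 2) ∧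
      ∀ m : ℕ, 1 ≤ m → t < r ^ m →
        0 ≤ (padicValNat 2 r : ℤ) * ((padicValNat 2 r : ℤ) * m - padicValNat 2 t - 2) →
        m₀ ≤ m)
    (hn₀ : 1 ≤ n₀ ∧ t < s ^ n₀ ∧
      0 ≤ (padicValNat 2 s : ℤ) * ((padicValNat 2 s : ℤ) * n₀ - padicValNat 2 t - 2) ∧
      ∀ n : ℕ, 1 ≤ n → t < s ^ n →
        0 ≤ (padicValNat 2 s : ℤ) * ((padicValNat 2 s : ℤ) * n - padicValNat 2 t - 2) →
        n₀ ≤ n) :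
    Vset r s t m₀ n₀ ε₁ ε₂ = ∅ ∨
      Vset r s t m₀ n₀ ε₁ ε₂ = {p : ℕ × ℕ | m₀ ≤ p.1 ∧ n₀ ≤ p.2} := by
  obtain ⟨-, hmt, hmv, -⟩ := hm₀
  obtain ⟨-, hnt, hnv, -⟩ := hn₀
  have hm_lt (m : ℕ) (hm : m₀ ≤ m) : t < r ^ m :=
    hmt.trans_le (Nat.pow_le_pow_right (by omega) hm)
  have hn_lt (n : ℕ) (hn : n₀ ≤ n) : t < s ^ n :=
    hnt.trans_le (Nat.pow_le_pow_right (by omega) hn)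
  have sub_ne {x : ℕ} (hx : t < x) {η : ℤ} (hη : η = 1 ∨ η = -1) : (x : ℤ) - η * t ≠ 0 := by
    rcases hη with rfl | rfl <;> omega
  have hA (m : ℕ) (hm : m₀ ≤ m) (η : ℤ) (hη : η = 1 ∨ η = -1) : (r : ℤ) ^ m - η * t ≠ 0 := by
    exact_mod_cast sub_ne (hm_lt m hm) hη
  have hB (n : ℕ) (hn : n₀ ≤ n) (κ : ℤ) (hκ : κ = 1 ∨ κ = -1) : (s : ℤ) ^ n - κ * t ≠ 0 := by
    exact_mod_cast sub_ne (hn_lt n hn) hκ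
  have hR := signValuationDichotomy_pow_sub ht hr hm_lt hmv
  have hS := signValuationDichotomy_pow_sub ht hs hn_lt hnv
  suffices h : ∃ c : Prop, ∀ m n : ℕ, m₀ ≤ m → n₀ ≤ n →
      ((∃ η κ : ℤ, (η = 1 ∨ η = -1) ∧ (κ = 1 ∨ κ = -1) ∧ ∃ lam : ℂ, lam ≠ 0 ∧
        lam ^ ((r : ℤ) ^ m - η * t) = ε₁ ∧ lam ^ ((s : ℤ) ^ n - κ * t) = ε₂) ↔ c) by
    obtain ⟨c, hc⟩ := h
    by_cases h : c
    · right
      ext ⟨m, n⟩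
      refine ⟨fun hp => ⟨hp.1, hp.2.1⟩, fun hp => ⟨hp.1, hp.2, ?_⟩⟩
      obtain ⟨η, κ, hη, hκ, lam, h0, h1, h2⟩ := (hc m n hp.1 hp.2).2 h
      exact ⟨lam, η, κ, h0, hη, hκ, h1, h2⟩
    · left
      ext ⟨m, n⟩
      refine ⟨?_, False.elim⟩
      rintro ⟨hm, hn, lam, η, κ, h0, hη, hκ, h1, h2⟩
      exact h ((hc m n hm hn).1 ⟨η, κ, hη, hκ, lam, h0, h1, h2⟩)
  rcases hε₁ with rfl | rfl <;> rcases hε₂ with rfl | rfl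
  · exact ⟨True, fun m n _ _ => iff_true_intro ⟨1, 1, .inl rfl, .inl rfl, 1, one_ne_zero, by simp⟩⟩
  · obtain ⟨c, hc⟩ := exists_sign_iff_lt hS hR
    refine ⟨c, fun m n hm hn => (Iff.trans ?_ (hc n m hn hm))⟩
    rw [exists_comm]
    refine exists_congr fun κ => exists_congr fun η => ?_
    rw [and_left_comm]
    refine and_congr_right fun hκ => and_congr_right fun hη => ?_
    rw [← exists_zpow_eq_neg_one_and_one_iff (hB n hn κ hκ) (hA m hm η hη)]
    simp only [and_comm]
  · obtain ⟨c, hc⟩ := exists_sign_iff_lt hR hS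
    refine ⟨c, fun m n hm hn => (Iff.trans ?_ (hc m n hm hn))⟩
    refine exists_congr fun η => exists_congr fun κ => and_congr_right fun hη =>
      and_congr_right fun hκ => ?_
    exact exists_zpow_eq_neg_one_and_one_iff (hA m hm η hη) (hB n hn κ hκ)
  · obtain ⟨c, hc⟩ := exists_sign_iff_eq hR hS
    refine ⟨c, fun m n hm hn => (Iff.trans ?_ (hc m n hm hn))⟩
    refine exists_congr fun η => exists_congr fun κ => and_congr_right fun hη =>
      and_congr_right fun hκ => ?_
    exact exists_zpow_eq_neg_one_and_neg_one_iff (hA m hm η hη) (hB n hn κ hκ)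
end

section
/- Let k ≥ 1 be an integer and let ξ ∈ ℂ be a primitive k-th root of unity. Let a, b, d₁, d₂, d₃, d₄ be integers with |d₁| ≥ 2 and |d₂| ≥ 2. Then for every pair (m,n) ∈ ℤ≥0² with |d₁|^m > |d₃| and |d₂|^n > |d₄|, the following are equivalent: (1) there exists λ ∈ ℂ^× with λ^{d₁^m − d₃} = ξ^a and λ^{d₂^n − d₄} = ξ^b (integer exponents); (2) k·gcd(|d₁^m − d₃|, |d₂^n − d₄|) divides b·(d₁^m − d₃) − a·(d₂^n − d₄). -/
theorem IsPrimitiveRoot.zpow_eq_zpow_iff_dvd {K : Type*} [Field K] {ξ : K} {k : ℕ}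
    (hξ : IsPrimitiveRoot ξ k) (hξ₀ : ξ ≠ 0) (i j : ℤ) :
    ξ ^ i = ξ ^ j ↔ (k : ℤ) ∣ i - j := by
  rw [← hξ.zpow_eq_one_iff_dvd, zpow_sub₀ hξ₀, div_eq_one_iff_eq (zpow_ne_zero _ hξ₀)]

/-- Simultaneous extraction of an `M`-th root of `ξ ^ a` and an `N`-th root of `ξ ^ b`. -/
theorem IsPrimitiveRoot.exists_zpow_eq_zpow_iff {K : Type*} [Field K] [IsAlgClosed K]
    {ξ : K} {k : ℕ} (hξ : IsPrimitiveRoot ξ k) (hξ₀ : ξ ≠ 0) (a b : ℤ) {M N : ℤ} (hM : M ≠ 0) :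
    (∃ z : K, z ≠ 0 ∧ z ^ M = ξ ^ a ∧ z ^ N = ξ ^ b) ↔
      (k : ℤ) * Int.gcd M N ∣ b * M - a * N := by
  have hg : 0 < Int.gcd M N := Int.gcd_pos_of_ne_zero_left N hM
  have hg' : (Int.gcd M N : ℤ) ≠ 0 := by exact_mod_cast hg.ne'
  have hbez := Int.gcd_eq_gcd_ab M N
  obtain ⟨M', hM'⟩ := Int.gcd_dvd_left M N
  obtain ⟨N', hN'⟩ := Int.gcd_dvd_right M N
  generalize Int.gcdA M N = u at hbez
  generalize Int.gcdB M N = v at hbez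
  generalize Int.gcd M N = g at *
  subst hM' hN'
  have huv : M' * u + N' * v = 1 := mul_left_cancel₀ hg' (by linear_combination -hbez)
  have hfac : b * (g * M') - a * (g * N') = (b * M' - a * N') * g := by ring
  rw [hfac, mul_dvd_mul_iff_right hg']
  constructor
  · rintro ⟨z, -, hza, hzb⟩
    rw [← hξ.zpow_eq_zpow_iff_dvd hξ₀, zpow_mul, zpow_mul, ← hza, ← hzb, ← zpow_mul, ← zpow_mul]
    congr 1
    ring
  · rintro ⟨c, hc⟩
    obtain ⟨z, hz⟩ := IsAlgClosed.exists_pow_nat_eq (ξ ^ (u * a + v * b)) hg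
    refine ⟨z, ?_, ?_, ?_⟩
    · rintro rfl
      rw [zero_pow hg.ne'] at hz
      exact zpow_ne_zero _ hξ₀ hz.symm
    · rw [zpow_mul, zpow_natCast, hz, ← zpow_mul, hξ.zpow_eq_zpow_iff_dvd hξ₀]
      exact ⟨v * c, by linear_combination a * huv + v * hc⟩
    · rw [zpow_mul, zpow_natCast, hz, ← zpow_mul, hξ.zpow_eq_zpow_iff_dvd hξ₀]
      exact ⟨-u * c, by linear_combination b * huv - u * hc⟩

theorem exists_lambda_iff_gcd_dvd (k : ℕ) (hk : 1 ≤ k) (ξ : ℂ)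
    (hξ : IsPrimitiveRoot ξ k)
    (a b d₁ d₂ d₃ d₄ : ℤ) (h1 : 2 ≤ |d₁|) (h2 : 2 ≤ |d₂|)
    (m n : ℕ) (hm : |d₃| < |d₁| ^ m) (hn : |d₄| < |d₂| ^ n) :
    (∃ lam : ℂ, lam ≠ 0 ∧ lam ^ (d₁ ^ m - d₃) = ξ ^ a ∧ lam ^ (d₂ ^ n - d₄) = ξ ^ b) ↔
      ((k : ℤ) * Int.gcd (d₁ ^ m - d₃) (d₂ ^ n - d₄)) ∣
        (b * (d₁ ^ m - d₃) - a * (d₂ ^ n - d₄)) := by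
  refine hξ.exists_zpow_eq_zpow_iff (hξ.ne_zero (by omega)) a b fun h => ?_
  rw [← abs_pow, ← sub_eq_zero.mp h] at hm
  exact lt_irrefl _ hm
end
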